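/- Let J be a positive integer, Λ and Σ J×J real symmetric positive definite matrices, θ ∈ ℝ^J, and 0 < ε < 1. Let x be a random vector in ℝ^J whose law is the probability measure proportional to the measure [ε·(Gaussian with mean 0, covariance Λ) + (1−ε)·(Dirac at 0)] reweighted by the density x ↦ 𝒩_J(x; θ, Σ). Set φ = (Λ⁻¹ + Σ⁻¹)⁻¹ Σ⁻¹ θ and t = 1 / (1 + ((1−ε)/ε) · (det(Λ+Σ))^{1/2}/(det Σ)^{1/2} · exp(−(1/2) θᵀ (Σ⁻¹ − (Σ+Λ)⁻¹) θ)). Then the covariance matrix of x satisfies Cov(x) = t·(φφᵀ + (Λ⁻¹ + Σ⁻¹)⁻¹) − t²·φφᵀ. -/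

import Mathlib

open MeasureTheory Matrix

/-- The multivariate Gaussian density `𝒩_J(x; m, C)` on `ℝ^J`. -/
noncomputable def gaussDensity {J : ℕ} (C : Matrix (Fin J) (Fin J) ℝ) (m x : Fin J → ℝ) : ℝ :=
  (2 * Real.pi) ^ (-(J : ℝ) / 2) * C.det ^ (-(1 : ℝ) / 2) *
    Real.exp (-(1 / 2) * ((x - m) ⬝ᵥ (C⁻¹ *ᵥ (x - m))))

open ProbabilityTheory

lemma gaussDensity_pos {J : ℕ} {C : Matrix (Fin J) (Fin J) ℝ} (hC : C.PosDef)
    (m x : Fin J → ℝ) : 0 < gaussDensity C m x := by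
  have := hC.det_pos
  unfold gaussDensity
  positivity

@[fun_prop]
lemma measurable_gaussDensity {J : ℕ} (C : Matrix (Fin J) (Fin J) ℝ) (m : Fin J → ℝ) :
    Measurable (gaussDensity C m) := by
  have : Continuous (gaussDensity C m) := by unfold gaussDensity; fun_prop
  exact this.measurable

/-- The standard Gaussian density on `ℝ^J` is a product of one-dimensional ones. -/
lemma gaussDensity_one_zero {J : ℕ} (x : Fin J → ℝ) :
    gaussDensity 1 0 x = ∏ i, gaussianPDFReal 0 1 (x i) := by
  simp only [gaussDensity, gaussianPDFReal, det_one, Real.one_rpow, sub_zero, inv_one, one_mulVec,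
    mul_one, NNReal.coe_one, Finset.prod_mul_distrib, Finset.prod_const, Finset.card_univ,
    Fintype.card_fin, ← Real.exp_sum]
  congr 1
  · rw [Real.sqrt_eq_rpow, ← Real.rpow_neg (by positivity), ← Real.rpow_mul_natCast (by positivity)]
    congr 1
    ring
  · simp only [dotProduct, Finset.mul_sum]
    congr 1
    refine Finset.sum_congr rfl fun i _ => ?_
    ring

/-- The standard Gaussian product measure has the standard Gaussian density. -/
lemma pi_gaussianReal_eq_withDensity (J : ℕ) :
    Measure.pi (fun _ : Fin J => gaussianReal 0 1) =
      volume.withDensity fun x => ENNReal.ofReal (gaussDensity 1 0 x) := by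
  refine Measure.pi_eq fun s hs => ?_
  have hint : ∀ i, IntegrableOn (gaussianPDFReal 0 1) (s i) := fun i =>
    (integrable_gaussianPDFReal 0 1).integrableOn
  rw [withDensity_apply _ (MeasurableSet.univ_pi hs), volume_pi, Measure.restrict_pi_pi]
  simp_rw [gaussDensity_one_zero]
  rw [← ofReal_integral_eq_lintegral_ofReal, integral_fintype_prod_eq_prod,
    ENNReal.ofReal_prod_of_nonneg]
  · exact Finset.prod_congr rfl fun i _ => (gaussianReal_apply_eq_integral 0 one_ne_zero (s i)).symm
  · exact fun i _ => integral_nonneg fun x => gaussianPDFReal_nonneg 0 1 x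
  · exact Integrable.fintype_prod hint
  · exact ae_of_all _ fun x => Finset.prod_nonneg fun i _ => gaussianPDFReal_nonneg 0 1 (x i)

lemma gaussDensity_affine {J : ℕ} {A : Matrix (Fin J) (Fin J) ℝ} (hA : A.det ≠ 0)
    (m x : Fin J → ℝ) :
    gaussDensity 1 0 x = |A.det| * gaussDensity (A * Aᵀ) m (m + A *ᵥ x) := by
  have hu : IsUnit A.det := hA.isUnit
  have hq : (A *ᵥ x) ⬝ᵥ ((A * Aᵀ)⁻¹ *ᵥ (A *ᵥ x)) = x ⬝ᵥ x := by
    rw [mulVec_mulVec, Matrix.mul_inv_rev, Matrix.mul_assoc, nonsing_inv_mul _ hu, Matrix.mul_one,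
      ← vecMul_transpose, ← dotProduct_mulVec, mulVec_mulVec, ← transpose_nonsing_inv,
      ← transpose_mul, nonsing_inv_mul _ hu, transpose_one, one_mulVec]
  have hd : (A * Aᵀ).det ^ (-(1 : ℝ) / 2) = |A.det|⁻¹ := by
    rw [det_mul, det_transpose, ← abs_mul_abs_self, ← pow_two, ← Real.rpow_natCast,
      ← Real.rpow_mul (abs_nonneg _), ← Real.rpow_neg_one]
    norm_num
  have h0 : |A.det| ≠ 0 := abs_ne_zero.mpr hA
  simp only [gaussDensity, add_sub_cancel_left, hq, hd, sub_zero, inv_one, one_mulVec, det_one,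
    Real.one_rpow]
  field_simp

lemma withDensity_comp_map {α β : Type*} [MeasurableSpace α] [MeasurableSpace β]
    (μ : Measure α) {T : α → β} (hT : Measurable T) {g : β → ENNReal} (hg : Measurable g) :
    (μ.withDensity fun x => g (T x)).map T = (μ.map T).withDensity g := by
  ext s hs
  rw [Measure.map_apply hT hs, withDensity_apply _ (hT hs), withDensity_apply _ hs,
    setLIntegral_map hs hg hT]

/-- The measure with density `𝒩_J(·; m, A Aᵀ)` is the law of `m + A z` for `z` standard Gaussian. -/
lemma withDensity_gaussDensity_eq_map {J : ℕ} {A : Matrix (Fin J) (Fin J) ℝ} (hA : A.det ≠ 0)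
    (m : Fin J → ℝ) :
    volume.withDensity (fun x => ENNReal.ofReal (gaussDensity (A * Aᵀ) m x)) =
      (Measure.pi fun _ : Fin J => gaussianReal 0 1).map fun z => m + A *ᵥ z := by
  have hT : Measurable fun z : Fin J → ℝ => m + A *ᵥ z := by
    have : Continuous fun z : Fin J → ℝ => m + A *ᵥ z := by fun_prop
    exact this.measurable
  have hvol : (volume : Measure (Fin J → ℝ)).map (fun z => m + A *ᵥ z) =
      ENNReal.ofReal |A.det⁻¹| • volume := by
    have h := Real.map_matrix_volume_pi_eq_smul_volume_pi hA
    have hL : Measurable (toLin' A) := (toLin' A).continuous_of_finiteDimensional.measurable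
    have : (fun z : Fin J → ℝ => m + A *ᵥ z) = (fun y => m + y) ∘ toLin' A := by
      ext; simp
    rw [this, ← Measure.map_map (by fun_prop) hL, h, Measure.map_smul,
      (measurePreserving_add_left volume m).map_eq]
  rw [pi_gaussianReal_eq_withDensity]
  simp_rw [gaussDensity_affine hA m, ENNReal.ofReal_mul (abs_nonneg A.det)]
  rw [show (fun x => ENNReal.ofReal |A.det| *
      ENNReal.ofReal (gaussDensity (A * Aᵀ) m (m + A *ᵥ x))) = ENNReal.ofReal |A.det| • fun x =>
      ENNReal.ofReal (gaussDensity (A * Aᵀ) m (m + A *ᵥ x)) from rfl,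
    withDensity_smul' _ _ ENNReal.ofReal_ne_top, Measure.map_smul,
    withDensity_comp_map volume hT (g := fun y => ENNReal.ofReal (gaussDensity (A * Aᵀ) m y))
      (by fun_prop), hvol, withDensity_smul_measure, smul_smul, ← ENNReal.ofReal_mul (abs_nonneg _),
    ← abs_mul, mul_inv_cancel₀ hA, abs_one, ENNReal.ofReal_one, one_smul]

open scoped MatrixOrder Matrix.Norms.L2Operator in
lemma Matrix.PosDef.exists_mul_transpose {J : ℕ} {C : Matrix (Fin J) (Fin J) ℝ} (hC : C.PosDef) :
    ∃ A : Matrix (Fin J) (Fin J) ℝ, A.det ≠ 0 ∧ A * Aᵀ = C := by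
  obtain ⟨B, hB⟩ := CStarAlgebra.nonneg_iff_eq_star_mul_self.mp hC.posSemidef.nonneg
  have hd : (Bᴴ * B).det ≠ 0 := by
    have := hC.det_pos.ne'
    rwa [hB] at this
  refine ⟨Bᴴ, left_ne_zero_of_mul (det_mul Bᴴ B ▸ hd), ?_⟩
  rw [hB, conjTranspose_eq_transpose_of_trivial, transpose_transpose,
    star_eq_conjTranspose, conjTranspose_eq_transpose_of_trivial]

lemma memLp_eval_pi_gaussianReal {J : ℕ} (k : Fin J) :
    MemLp (fun z : Fin J → ℝ => z k) 2 (Measure.pi fun _ : Fin J => gaussianReal 0 1) :=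
  (memLp_id_gaussianReal' 2 (by simp)).comp_measurePreserving
    (measurePreserving_eval (fun _ : Fin J => gaussianReal 0 1) k)

lemma integral_eval_pi_gaussianReal {J : ℕ} (k : Fin J) :
    ∫ z, z k ∂(Measure.pi fun _ : Fin J => gaussianReal 0 1) = 0 := by
  have := integral_comp_eval (μ := fun _ : Fin J => gaussianReal 0 1) (i := k) (f := fun x : ℝ => x)
    (by fun_prop)
  rw [this, integral_id_gaussianReal]

lemma covariance_eval_pi_gaussianReal {J : ℕ} (k l : Fin J) :
    cov[fun z : Fin J → ℝ => z k, fun z => z l; Measure.pi fun _ : Fin J => gaussianReal 0 1] =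
      (1 : Matrix (Fin J) (Fin J) ℝ) k l := by
  rcases eq_or_ne k l with rfl | hkl
  · rw [covariance_self (measurable_pi_apply k).aemeasurable, one_apply_eq]
    have h := (measurePreserving_eval (fun _ : Fin J => gaussianReal 0 1) k)
    have := variance_map (μ := Measure.pi fun _ : Fin J => gaussianReal 0 1) (X := id)
      (Y := fun z => z k) (by fun_prop) (measurable_pi_apply k).aemeasurable
    rw [show (fun z : Fin J → ℝ => z k) = id ∘ fun z => z k from rfl, ← this]
    erw [h.map_eq]
    simp
  · rw [one_apply_ne hkl]
    refine IndepFun.covariance_eq_zero ?_ (memLp_eval_pi_gaussianReal k)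
      (memLp_eval_pi_gaussianReal l)
    exact (iIndepFun_pi (μ := fun _ : Fin J => gaussianReal 0 1) (X := fun _ => id)
      fun i => by fun_prop).indepFun hkl

/-- The Gaussian measure with mean `m` and covariance `C`, given by its density. -/
noncomputable def gaussMeasure {J : ℕ} (C : Matrix (Fin J) (Fin J) ℝ) (m : Fin J → ℝ) :
    Measure (Fin J → ℝ) :=
  volume.withDensity fun x => ENNReal.ofReal (gaussDensity C m x)

section Moments

variable {J : ℕ} {C : Matrix (Fin J) (Fin J) ℝ}

lemma gaussMeasure_eq_map (hC : C.PosDef) (m : Fin J → ℝ) :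
    ∃ A : Matrix (Fin J) (Fin J) ℝ, A * Aᵀ = C ∧
      MeasurePreserving (fun z => m + A *ᵥ z) (Measure.pi fun _ : Fin J => gaussianReal 0 1)
        (gaussMeasure C m) := by
  obtain ⟨A, hA, rfl⟩ := hC.exists_mul_transpose
  have : Continuous fun z : Fin J → ℝ => m + A *ᵥ z := by fun_prop
  exact ⟨A, rfl, this.measurable, (withDensity_gaussDensity_eq_map hA m).symm⟩

lemma isProbabilityMeasure_gaussMeasure (hC : C.PosDef) (m : Fin J → ℝ) :
    IsProbabilityMeasure (gaussMeasure C m) := by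
  obtain ⟨A, -, h⟩ := gaussMeasure_eq_map hC m
  rw [← h.map_eq]
  exact Measure.isProbabilityMeasure_map h.measurable.aemeasurable

lemma memLp_affine_pi_gaussianReal (A : Matrix (Fin J) (Fin J) ℝ) (m : Fin J → ℝ) (i : Fin J) :
    MemLp (fun z => (m + A *ᵥ z) i) 2 (Measure.pi fun _ : Fin J => gaussianReal 0 1) :=
  (memLp_const (m i)).add
    (memLp_finsetSum Finset.univ fun k _ => (memLp_eval_pi_gaussianReal k).const_mul (A i k))

lemma memLp_eval_gaussMeasure (hC : C.PosDef) (m : Fin J → ℝ) (i : Fin J) :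
    MemLp (fun x => x i) 2 (gaussMeasure C m) := by
  obtain ⟨A, -, h⟩ := gaussMeasure_eq_map hC m
  rw [← h.map_eq, memLp_map_measure_iff (measurable_pi_apply i).aestronglyMeasurable
    h.measurable.aemeasurable]
  exact memLp_affine_pi_gaussianReal A m i

lemma integral_eval_gaussMeasure (hC : C.PosDef) (m : Fin J → ℝ) (i : Fin J) :
    ∫ x, x i ∂(gaussMeasure C m) = m i := by
  obtain ⟨A, -, h⟩ := gaussMeasure_eq_map hC m
  have hz (k : Fin J) : Integrable (fun z : Fin J → ℝ => A i k * z k)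
      (Measure.pi fun _ : Fin J => gaussianReal 0 1) :=
    ((memLp_eval_pi_gaussianReal k).integrable one_le_two).const_mul _
  rw [← h.map_eq, integral_map h.measurable.aemeasurable
    (measurable_pi_apply i).aestronglyMeasurable]
  simp only [Pi.add_apply, mulVec, dotProduct]
  rw [integral_add (integrable_const _) (integrable_finsetSum _ fun k _ => hz k),
    integral_finsetSum _ fun k _ => hz k]
  simp [integral_const_mul, integral_eval_pi_gaussianReal]

lemma covariance_eval_gaussMeasure (hC : C.PosDef) (m : Fin J → ℝ) (i j : Fin J) :
    cov[fun x => x i, fun x => x j; gaussMeasure C m] = C i j := by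
  obtain ⟨A, rfl, h⟩ := gaussMeasure_eq_map hC m
  have hz (i k : Fin J) : MemLp (fun z : Fin J → ℝ => A i k * z k) 2
      (Measure.pi fun _ : Fin J => gaussianReal 0 1) :=
    (memLp_eval_pi_gaussianReal k).const_mul _
  have hs (i : Fin J) : Integrable (fun z : Fin J → ℝ => ∑ k, A i k * z k)
      (Measure.pi fun _ : Fin J => gaussianReal 0 1) :=
    integrable_finsetSum _ fun k _ => (hz i k).integrable one_le_two
  rw [← h.map_eq, covariance_map_fun (measurable_pi_apply i).aestronglyMeasurable
    (measurable_pi_apply j).aestronglyMeasurable h.measurable.aemeasurable]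
  simp only [Pi.add_apply, mulVec, dotProduct]
  rw [covariance_const_add_left (hs i), covariance_const_add_right (hs j),
    covariance_fun_sum_fun_sum (hz i) (hz j)]
  simp [covariance_const_mul_left, covariance_const_mul_right, covariance_eval_pi_gaussianReal,
    mul_apply, one_apply, mul_comm]

lemma integrable_eval_gaussMeasure (hC : C.PosDef) (m : Fin J → ℝ) (i : Fin J) :
    Integrable (fun x => x i) (gaussMeasure C m) := by
  have := isProbabilityMeasure_gaussMeasure hC m
  exact (memLp_eval_gaussMeasure hC m i).integrable one_le_two

lemma integrable_eval_mul_eval_gaussMeasure (hC : C.PosDef) (m : Fin J → ℝ) (i j : Fin J) :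
    Integrable (fun x => x i * x j) (gaussMeasure C m) :=
  (memLp_eval_gaussMeasure hC m i).integrable_mul (memLp_eval_gaussMeasure hC m j)

lemma integral_eval_mul_eval_gaussMeasure (hC : C.PosDef) (m : Fin J → ℝ) (i j : Fin J) :
    ∫ x, x i * x j ∂(gaussMeasure C m) = C i j + m i * m j := by
  have := isProbabilityMeasure_gaussMeasure hC m
  have h := covariance_eq_sub (memLp_eval_gaussMeasure hC m i) (memLp_eval_gaussMeasure hC m j)
  simp only [covariance_eval_gaussMeasure hC, integral_eval_gaussMeasure hC, Pi.mul_apply] at h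
  linarith

end Moments

section Product

variable {J : ℕ} {Λ S : Matrix (Fin J) (Fin J) ℝ}

lemma inv_add_inv_eq (hΛ : Λ.PosDef) (hS : S.PosDef) : Λ⁻¹ + S⁻¹ = Λ⁻¹ * (Λ + S) * S⁻¹ := by
  rw [Matrix.mul_add, nonsing_inv_mul _ hΛ.det_pos.ne'.isUnit, Matrix.add_mul, Matrix.one_mul,
    mul_nonsing_inv_cancel_right _ _ hS.det_pos.ne'.isUnit, add_comm]

lemma inv_inv_add_inv_eq (hΛ : Λ.PosDef) (hS : S.PosDef) :
    (Λ⁻¹ + S⁻¹)⁻¹ = S * (Λ + S)⁻¹ * Λ := by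
  rw [inv_add_inv_eq hΛ hS, Matrix.mul_inv_rev, Matrix.mul_inv_rev,
    nonsing_inv_nonsing_inv _ hΛ.det_pos.ne'.isUnit,
    nonsing_inv_nonsing_inv _ hS.det_pos.ne'.isUnit, Matrix.mul_assoc]

lemma inv_sub_inv_mul_mul_inv (hΛ : Λ.PosDef) (hS : S.PosDef) :
    S⁻¹ - S⁻¹ * (Λ⁻¹ + S⁻¹)⁻¹ * S⁻¹ = (Λ + S)⁻¹ := by
  have hSu := hS.det_pos.ne'.isUnit
  have h : (Λ + S)⁻¹ * (Λ + S) * S⁻¹ = S⁻¹ := by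
    rw [nonsing_inv_mul _ (hΛ.add hS).det_pos.ne'.isUnit, Matrix.one_mul]
  rw [Matrix.mul_add, Matrix.add_mul, mul_nonsing_inv_cancel_right _ _ hSu] at h
  rw [inv_inv_add_inv_eq hΛ hS, Matrix.mul_assoc S, nonsing_inv_mul_cancel_left _ _ hSu]
  nth_rw 1 [← h]
  abel

lemma dotProduct_mulVec_comm_of_isHermitian {P : Matrix (Fin J) (Fin J) ℝ} (hP : P.IsHermitian)
    (x y : Fin J → ℝ) : x ⬝ᵥ (P *ᵥ y) = y ⬝ᵥ (P *ᵥ x) := by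
  have hT : Pᵀ = P := by simpa [conjTranspose_eq_transpose_of_trivial] using hP.eq
  rw [dotProduct_mulVec, ← mulVec_transpose, hT, dotProduct_comm]

/-- Completing the square. -/
lemma quadratic_form_add (hΛ : Λ.PosDef) (hS : S.PosDef) (θ x : Fin J → ℝ) {φ : Fin J → ℝ}
    (hφ : φ = (Λ⁻¹ + S⁻¹)⁻¹ *ᵥ (S⁻¹ *ᵥ θ)) :
    x ⬝ᵥ (Λ⁻¹ *ᵥ x) + (x - θ) ⬝ᵥ (S⁻¹ *ᵥ (x - θ)) =
      θ ⬝ᵥ ((Λ + S)⁻¹ *ᵥ θ) + (x - φ) ⬝ᵥ ((Λ⁻¹ + S⁻¹) *ᵥ (x - φ)) := by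
  have hP := hΛ.inv.add hS.inv
  have hPφ : (Λ⁻¹ + S⁻¹) *ᵥ φ = S⁻¹ *ᵥ θ := by
    rw [hφ, mulVec_mulVec, mul_nonsing_inv _ hP.det_pos.ne'.isUnit, one_mulVec]
  have hφφ : φ ⬝ᵥ (S⁻¹ *ᵥ θ) = θ ⬝ᵥ (S⁻¹ *ᵥ θ) - θ ⬝ᵥ ((Λ + S)⁻¹ *ᵥ θ) := by
    rw [dotProduct_mulVec_comm_of_isHermitian hS.inv.isHermitian, hφ,
      ← inv_sub_inv_mul_mul_inv hΛ hS, sub_mulVec, dotProduct_sub]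
    simp only [mulVec_mulVec, Matrix.mul_assoc]
    ring
  have hφx := dotProduct_mulVec_comm_of_isHermitian hP.isHermitian φ x
  have hθx := dotProduct_mulVec_comm_of_isHermitian hS.inv.isHermitian θ x
  simp only [mulVec_sub, sub_dotProduct, dotProduct_sub, hφx, hPφ, hφφ, hθx]
  rw [add_mulVec, dotProduct_add]
  ring

/-- The product of two Gaussian densities is a multiple of a Gaussian density. -/
lemma gaussDensity_mul_gaussDensity (hΛ : Λ.PosDef) (hS : S.PosDef) (θ x : Fin J → ℝ) :
    gaussDensity Λ 0 x * gaussDensity S θ x = gaussDensity (Λ + S) 0 θ *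
      gaussDensity (Λ⁻¹ + S⁻¹)⁻¹ ((Λ⁻¹ + S⁻¹)⁻¹ *ᵥ (S⁻¹ *ᵥ θ)) x := by
  have hdet : Λ.det ^ (-(1 : ℝ) / 2) * S.det ^ (-(1 : ℝ) / 2) =
      (Λ + S).det ^ (-(1 : ℝ) / 2) * (Λ⁻¹ + S⁻¹)⁻¹.det ^ (-(1 : ℝ) / 2) := by
    have h := (hΛ.add hS).det_pos
    have hK := (hΛ.inv.add hS.inv).inv.det_pos
    rw [← Real.mul_rpow hΛ.det_pos.le hS.det_pos.le, ← Real.mul_rpow h.le hK.le,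
      inv_inv_add_inv_eq hΛ hS, det_mul, det_mul, det_nonsing_inv, Ring.inverse_eq_inv']
    congr 1
    field_simp
  have hexp := quadratic_form_add hΛ hS θ x rfl
  simp only [gaussDensity, sub_zero]
  rw [nonsing_inv_nonsing_inv _ (hΛ.inv.add hS.inv).det_pos.ne'.isUnit]
  rw [mul_mul_mul_comm, mul_mul_mul_comm _ (Λ.det ^ _), hdet, ← Real.exp_add, ← mul_add, hexp,
    mul_add, Real.exp_add]
  ring

end Product

/-- Reweighting the spike-and-slab measure by a Gaussian density gives a mixture of a Gaussian
measure and a Dirac mass. -/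
lemma spikeSlab_withDensity_gaussDensity {J : ℕ} {Λ Sig : Matrix (Fin J) (Fin J) ℝ}
    (hΛ : Λ.PosDef) (hSig : Sig.PosDef) (θ : Fin J → ℝ) {ε : ℝ} (hε0 : 0 < ε) (hε1 : ε < 1) :
    (ENNReal.ofReal ε • volume.withDensity (fun x => ENNReal.ofReal (gaussDensity Λ 0 x))
        + ENNReal.ofReal (1 - ε) • Measure.dirac 0).withDensity
          (fun x => ENNReal.ofReal (gaussDensity Sig θ x)) =
      ENNReal.ofReal (ε * gaussDensity (Λ + Sig) 0 θ) •
          gaussMeasure (Λ⁻¹ + Sig⁻¹)⁻¹ ((Λ⁻¹ + Sig⁻¹)⁻¹ *ᵥ (Sig⁻¹ *ᵥ θ)) +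
        ENNReal.ofReal ((1 - ε) * gaussDensity Sig 0 θ) • Measure.dirac 0 := by
  have hmeas (C : Matrix (Fin J) (Fin J) ℝ) (m : Fin J → ℝ) :
      Measurable fun x => ENNReal.ofReal (gaussDensity C m x) := by fun_prop
  have hzero : gaussDensity Sig θ 0 = gaussDensity Sig 0 θ := by
    simp [gaussDensity, mulVec_neg]
  rw [withDensity_add_measure, withDensity_smul_measure, withDensity_smul_measure,
    dirac_withDensity' (hmeas _ _), ← withDensity_mul _ (hmeas _ _) (hmeas _ _), hzero, smul_smul,
    ← ENNReal.ofReal_mul (sub_nonneg.mpr hε1.le), ENNReal.ofReal_mul hε0.le, mul_smul, gaussMeasure,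
    ← withDensity_smul _ (hmeas _ _)]
  congr 3
  ext x
  simp only [Pi.mul_apply, Pi.smul_apply, smul_eq_mul]
  rw [← ENNReal.ofReal_mul (gaussDensity_pos hΛ _ _).le, gaussDensity_mul_gaussDensity hΛ hSig,
    ENNReal.ofReal_mul (gaussDensity_pos (hΛ.add hSig) _ _).le]

lemma gaussDensity_div_gaussDensity {J : ℕ} {C D : Matrix (Fin J) (Fin J) ℝ} (hC : C.PosDef)
    (hD : D.PosDef) (θ : Fin J → ℝ) :
    gaussDensity C 0 θ / gaussDensity D 0 θ = D.det ^ ((1 : ℝ) / 2) / C.det ^ ((1 : ℝ) / 2) *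
      Real.exp (-(1 / 2) * (θ ⬝ᵥ ((C⁻¹ - D⁻¹) *ᵥ θ))) := by
  have hc := hC.det_pos
  have hd := hD.det_pos
  simp only [gaussDensity, sub_zero, sub_mulVec, dotProduct_sub, mul_sub, Real.exp_sub, neg_div,
    Real.rpow_neg hc.le, Real.rpow_neg hd.le]
  field_simp

lemma integral_mixture {J : ℕ} {γ : Measure (Fin J → ℝ)} {a b : ℝ} (ha : 0 ≤ a)
    {f : (Fin J → ℝ) → ℝ} (hf : Integrable f γ) (hf0 : f 0 = 0) :
    ∫ x, f x ∂(ENNReal.ofReal a • γ + ENNReal.ofReal b • Measure.dirac 0) = a * ∫ x, f x ∂γ := by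
  rw [integral_add_measure (hf.smul_measure ENNReal.ofReal_ne_top)
    ((integrable_dirac (by simp [hf0])).smul_measure ENNReal.ofReal_ne_top), integral_smul_measure,
    integral_smul_measure, integral_dirac, hf0, ENNReal.toReal_ofReal ha]
  simp

theorem stmt2 (J : ℕ) (hJ : 0 < J) (Λ Sig : Matrix (Fin J) (Fin J) ℝ)
    (hΛ : Λ.PosDef) (hSig : Sig.PosDef) (θ : Fin J → ℝ) (ε : ℝ) (hε0 : 0 < ε) (hε1 : ε < 1)
    (μ₀ : Measure (Fin J → ℝ))
    (hμ₀ : μ₀ = (ENNReal.ofReal ε •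
          volume.withDensity (fun x => ENNReal.ofReal (gaussDensity Λ 0 x))
        + ENNReal.ofReal (1 - ε) • Measure.dirac 0).withDensity
          (fun x => ENNReal.ofReal (gaussDensity Sig θ x)))
    -- the law of `x`: the probability measure proportional to `μ₀`
    (μ : Measure (Fin J → ℝ)) (hμ : μ = (μ₀ Set.univ)⁻¹ • μ₀)
    (φ : Fin J → ℝ) (hφ : φ = (Λ⁻¹ + Sig⁻¹)⁻¹ *ᵥ (Sig⁻¹ *ᵥ θ))
    (t : ℝ) (ht : t = 1 / (1 + (1 - ε) / ε * ((Λ + Sig).det ^ ((1 : ℝ) / 2) / Sig.det ^ ((1 : ℝ) / 2)) *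
      Real.exp (-(1 / 2) * (θ ⬝ᵥ ((Sig⁻¹ - (Sig + Λ)⁻¹) *ᵥ θ)))))
    -- the covariance matrix `Cov(x) = E[xxᵀ] − E[x]E[x]ᵀ` (entrywise)
    (Cov : Matrix (Fin J) (Fin J) ℝ)
    (hCov : Cov = fun i j => (∫ x, x i * x j ∂μ) - (∫ x, x i ∂μ) * (∫ x, x j ∂μ)) :
    Cov = t • (vecMulVec φ φ + (Λ⁻¹ + Sig⁻¹)⁻¹) - t ^ 2 • vecMulVec φ φ := by
  have hw1 : 0 < ε * gaussDensity (Λ + Sig) 0 θ := mul_pos hε0 (gaussDensity_pos (hΛ.add hSig) _ _)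
  have hw2 : 0 < (1 - ε) * gaussDensity Sig 0 θ :=
    mul_pos (sub_pos.mpr hε1) (gaussDensity_pos hSig _ _)
  have hK := (hΛ.inv.add hSig.inv).inv
  have hprob := isProbabilityMeasure_gaussMeasure hK φ
  rw [spikeSlab_withDensity_gaussDensity hΛ hSig θ hε0 hε1, ← hφ] at hμ₀
  have ht' : t = (ε * gaussDensity (Λ + Sig) 0 θ + (1 - ε) * gaussDensity Sig 0 θ)⁻¹ *
      (ε * gaussDensity (Λ + Sig) 0 θ) := by
    have h1 := gaussDensity_pos (hΛ.add hSig) 0 θ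
    have h2 := gaussDensity_pos hSig 0 θ
    rw [ht, mul_assoc, add_comm Sig Λ, ← gaussDensity_div_gaussDensity hSig (hΛ.add hSig)]
    field_simp
  have huniv : μ₀ Set.univ =
      ENNReal.ofReal (ε * gaussDensity (Λ + Sig) 0 θ + (1 - ε) * gaussDensity Sig 0 θ) := by
    simp [hμ₀, ENNReal.ofReal_add hw1.le hw2.le]
  have hmoment {f : (Fin J → ℝ) → ℝ} (hf : Integrable f (gaussMeasure (Λ⁻¹ + Sig⁻¹)⁻¹ φ))
      (hf0 : f 0 = 0) : ∫ x, f x ∂μ = t * ∫ x, f x ∂(gaussMeasure (Λ⁻¹ + Sig⁻¹)⁻¹ φ) := by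
    rw [hμ, integral_smul_measure, huniv, hμ₀, integral_mixture hw1.le hf hf0,
      ENNReal.toReal_inv, ENNReal.toReal_ofReal (add_pos hw1 hw2).le, ht', smul_eq_mul,
      mul_assoc _ (ε * _)]
  rw [hCov]
  ext i j
  rw [hmoment (integrable_eval_mul_eval_gaussMeasure hK φ i j) (by simp),
    hmoment (integrable_eval_gaussMeasure hK φ i) rfl,
    hmoment (integrable_eval_gaussMeasure hK φ j) rfl,
    integral_eval_mul_eval_gaussMeasure hK, integral_eval_gaussMeasure hK,
    integral_eval_gaussMeasure hK]
  simp only [Matrix.sub_apply, Matrix.smul_apply, Matrix.add_apply, vecMulVec_apply, smul_eq_mul]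
  ring
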